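/- Let T = (Q, Σ, δ) be a reversible but not bi-reversible G-automaton whose dual automaton ∂T is connected (the underlying undirected graph on its state set Σ is connected). Then every ω-word ξ ∈ Σ^ω has an infinite orbit Q*∘ξ. -/

import Mathlib

/- Common framework for automaton semigroups acting on finite and infinite words.

An S-automaton over states `Q` and alphabet `A` is given by a partial deterministic
transition function `δ : Q → A → Option (A × Q)` (with `δ q a = some (b, p)` encoding
the transition `q –a/b→ p`). -/

namespace AutOrbit

variable {Q A : Type*}

/-- The partial action `q∘` of a single state on a finite word. -/
def stateAct (δ : Q → A → Option (A × Q)) : Q → List A → Option (List A)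
  | _, [] => some []
  | q, a :: u => (δ q a).bind fun bp => (stateAct δ bp.2 u).map fun v => bp.1 :: v

/-- The partial action `𝐪∘` of a state sequence `𝐪 = q_n … q_1` (written left-to-right,
head of the list is `q_n`; the rightmost state `q_1` is applied first). -/
def seqAct (δ : Q → A → Option (A × Q)) (l : List Q) (u : List A) : Option (List A) :=
  l.foldr (fun q acc => acc.bind (stateAct δ q)) (some u)

/-- The length-`n` prefix of an ω-word. -/
def pre (ξ : ℕ → A) (n : ℕ) : List A := List.ofFn fun i : Fin n => ξ i

/-- The `L`-orbit `L∘u` of a finite word `u`. -/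
def orbit (δ : Q → A → Option (A × Q)) (L : Set (List Q)) (u : List A) : Set (List A) :=
  {v | ∃ l ∈ L, seqAct δ l u = some v}

/-- The `L`-orbit `L∘ξ` of an ω-word `ξ`: all ω-words `η` such that some `𝐪 ∈ L` is
defined on `ξ` with `𝐪∘ξ = η` (i.e. `𝐪∘` maps every prefix of `ξ` to the
corresponding prefix of `η`). -/
def omegaOrbit (δ : Q → A → Option (A × Q)) (L : Set (List Q)) (ξ : ℕ → A) :
    Set (ℕ → A) :=
  {η | ∃ l ∈ L, ∀ n, seqAct δ l (pre ξ n) = some (pre η n)}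

/-- The set of partial maps `L∘ = {𝐪∘ ∣ 𝐪 ∈ L}`. -/
def mapsOf (δ : Q → A → Option (A × Q)) (L : Set (List Q)) :
    Set (List A → Option (List A)) :=
  {f | ∃ l ∈ L, f = seqAct δ l}

/-- `L ⊆ F*` is suffix-closed over `F`: every `𝐪 ∈ L` factorizes into factors from `F`
such that every suffix (as a word over the alphabet `F`) of the factorization is
again in `L`. -/
def SuffixClosedOver (F L : Set (List Q)) : Prop :=
  ∀ l ∈ L, ∃ fs : List (List Q),
    (∀ f ∈ fs, f ∈ F) ∧ fs.flatten = l ∧ ∀ i, (fs.drop i).flatten ∈ L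

/-- `L` is finitely suffix-closed: suffix-closed over some finite nonempty `F ⊆ Q*`. -/
def FinitelySuffixClosed (L : Set (List Q)) : Prop :=
  ∃ F : Set (List Q), F.Finite ∧ F.Nonempty ∧ SuffixClosedOver F L

/-- `u` has infinite potential w.r.t. `δ` and `L`: the orbit sizes `|L∘ux|` are unbounded. -/
def InfinitePotential (δ : Q → A → Option (A × Q)) (L : Set (List Q)) (u : List A) : Prop :=
  ∀ C : ℕ, ∃ x : List A, C < (orbit δ L (u ++ x)).ncard

/-- The `i`-th power `𝐪^i` of a state sequence. -/
def listPow (l : List Q) (i : ℕ) : List Q := (List.replicate i l).flatten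

/-- `𝐪∘` has torsion: two distinct positive powers induce the same partial map. -/
def HasTorsion (δ : Q → A → Option (A × Q)) (l : List Q) : Prop :=
  ∃ i j : ℕ, 1 ≤ i ∧ 1 ≤ j ∧ i ≠ j ∧ seqAct δ (listPow l i) = seqAct δ (listPow l j)

/-- The automaton is complete: `δ` is total. -/
def Complete (δ : Q → A → Option (A × Q)) : Prop := ∀ q a, (δ q a).isSome

/-- The automaton is invertible: for every state, the letter-to-output-letter map is a
bijection of the alphabet (each output letter is produced by exactly one input letter). -/
def Invertible (δ : Q → A → Option (A × Q)) : Prop :=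
  ∀ q b, ∃! a, ∃ p, δ q a = some (b, p)

/-- A G-automaton: a complete invertible S-automaton. -/
def GAutomaton (δ : Q → A → Option (A × Q)) : Prop := Complete δ ∧ Invertible δ

/-- Reversibility: for every input letter `a` and target state `p` there is at most one
transition `q –a/b→ p`. -/
def Reversible (δ : Q → A → Option (A × Q)) : Prop :=
  ∀ a p q₁ b₁ q₂ b₂, δ q₁ a = some (b₁, p) → δ q₂ a = some (b₂, p) → q₁ = q₂

/-- Reversibility of the inverse automaton: for every output letter `b` and target
state `p` there is at most one transition `q –a/b→ p`. -/
def InvReversible (δ : Q → A → Option (A × Q)) : Prop :=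
  ∀ b p q₁ a₁ q₂ a₂, δ q₁ a₁ = some (b, p) → δ q₂ a₂ = some (b, p) → q₁ = q₂ ∧ a₁ = a₂

/-- Bi-reversibility: the automaton and its inverse automaton are both reversible. -/
def BiReversible (δ : Q → A → Option (A × Q)) : Prop := Reversible δ ∧ InvReversible δ

/-- The dual automaton `∂T`: states are letters, letters are states; it has a transition
`a –q/p→ b` for every transition `q –a/b→ p` of `T`. -/
def dual (δ : Q → A → Option (A × Q)) : A → Q → Option (Q × A) :=
  fun a q => (δ q a).map fun bp => (bp.2, bp.1)

/-- Adjacency of states in the underlying undirected graph of the automaton. -/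
def Adj (δ : Q → A → Option (A × Q)) (q p : Q) : Prop :=
  (∃ a b, δ q a = some (b, p)) ∨ (∃ a b, δ p a = some (b, q))

/-- `P` is (the state set of) a connected component of the automaton. -/
def IsComponent (δ : Q → A → Option (A × Q)) (P : Set Q) : Prop :=
  ∃ q, P = {p | Relation.ReflTransGen (Adj δ) q p}

/-- The sub-automaton induced on `P` (with all transitions among states of `P`)
is reversible. -/
def SubReversible (δ : Q → A → Option (A × Q)) (P : Set Q) : Prop :=
  ∀ a : A, ∀ p ∈ P, ∀ q₁ b₁ q₂ b₂, q₁ ∈ P → q₂ ∈ P →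
    δ q₁ a = some (b₁, p) → δ q₂ a = some (b₂, p) → q₁ = q₂

/-- The inverse of the sub-automaton induced on `P` is reversible. -/
def SubInvReversible (δ : Q → A → Option (A × Q)) (P : Set Q) : Prop :=
  ∀ b : A, ∀ p ∈ P, ∀ q₁ a₁ q₂ a₂, q₁ ∈ P → q₂ ∈ P →
    δ q₁ a₁ = some (b, p) → δ q₂ a₂ = some (b, p) → q₁ = q₂ ∧ a₁ = a₂

/-- The sub-automaton induced on `P` is bi-reversible. -/
def SubBiReversible (δ : Q → A → Option (A × Q)) (P : Set Q) : Prop :=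
  SubReversible δ P ∧ SubInvReversible δ P

/-- For a complete automaton, the (total) action of a state on a finite word. -/
noncomputable def totAct (δ : Q → A → Option (A × Q)) (q : Q) (u : List A) : List A :=
  (stateAct δ q u).getD u

/-- The action of a state of the automaton (`Sum.inl`) or of its inverse automaton
(`Sum.inr`): for a G-automaton, `totAct δ q` is a bijection of `Σ*` and the inverse
state `q̄` acts as its inverse bijection. -/
noncomputable def gAct (δ : Q → A → Option (A × Q)) : Q ⊕ Q → List A → List A
  | Sum.inl q => totAct δ q
  | Sum.inr q => Function.invFun (totAct δ q)

/-- Action of a sequence over `Q ⊔ Q̄` (rightmost entry applied first). -/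
noncomputable def gSeqAct (δ : Q → A → Option (A × Q)) (l : List (Q ⊕ Q)) (u : List A) :
    List A :=
  l.foldr (fun s v => gAct δ s v) u

/-- The automaton group `G(T) = {𝐪∘ ∣ 𝐪 ∈ (Q ⊔ Q̄)⁺}` as a set of maps on `Σ*`. -/
def autGroup (δ : Q → A → Option (A × Q)) : Set (List A → List A) :=
  {f | ∃ l : List (Q ⊕ Q), l ≠ [] ∧ f = gSeqAct δ l}

/-- The ultimately periodic ω-word `u (a v)^ω`. -/
def ultPer (u : List A) (a : A) (v : List A) (n : ℕ) : A :=
  if h : n < u.length then u.get ⟨n, h⟩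
  else (a :: v).get ⟨(n - u.length) % (a :: v).length, Nat.mod_lt _ (by simp)⟩

/-- Run of a single state on a word, returning the output word and the final state. -/
def runState (δ : Q → A → Option (A × Q)) : Q → List A → Option (List A × Q)
  | q, [] => some ([], q)
  | q, a :: u => (δ q a).bind fun bp =>
      (runState δ bp.2 u).map fun vr => (bp.1 :: vr.1, vr.2)

/-- Run of a state sequence `𝐪` on a word `u`, returning the output word `𝐪∘u` and the
residual state sequence `𝐪·u` (the dual action). -/
def runSeq (δ : Q → A → Option (A × Q)) : List Q → List A → Option (List A × List Q)
  | [], u => some (u, [])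
  | q :: l, u => (runSeq δ l u).bind fun vr =>
      (runState δ q vr.1).map fun wp => (wp.1, wp.2 :: vr.2)

/-- Nodes of the `L`-orbital transducer over `F` of `u`: words reached from `u` along a
path of `F`-labeled edges whose reverse label (a word over `F`) lies in `L`. -/
def transNodes (δ : Q → A → Option (A × Q)) (F L : Set (List Q)) (u : List A) :
    Set (List A) :=
  {v | ∃ fs : List (List Q), (∀ f ∈ fs, f ∈ F) ∧ fs.flatten ∈ L ∧
        ∃ r, runSeq δ fs.flatten u = some (v, r)}

/-- Edges of the `L`-orbital transducer over `F` of `u`: an edge `v –𝐩/𝐨→ w` with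
`𝐩 ∈ F`, input label `𝐩`, output label `𝐨 = 𝐩·v`, lying on a path from `u` whose
reverse label is in `L`. -/
def transEdge (δ : Q → A → Option (A × Q)) (F L : Set (List Q)) (u : List A)
    (v : List A) (p o : List Q) (w : List A) : Prop :=
  p ∈ F ∧ ∃ fs : List (List Q), (∀ f ∈ fs, f ∈ F) ∧ (p :: fs).flatten ∈ L ∧
    (∃ r, runSeq δ fs.flatten u = some (v, r)) ∧ runSeq δ p v = some (w, o)

/-- Isomorphism of the `L`-orbital transducers over `F` of `u₁` and `u₂`: a bijection of
the node sets mapping `u₁` to `u₂` and preserving labeled edges in both directions. -/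
def TransducerIso (δ : Q → A → Option (A × Q)) (F L : Set (List Q)) (u₁ u₂ : List A) :
    Prop :=
  ∃ φ : List A → List A,
    Set.BijOn φ (transNodes δ F L u₁) (transNodes δ F L u₂) ∧ φ u₁ = u₂ ∧
    ∀ v ∈ transNodes δ F L u₁, ∀ w ∈ transNodes δ F L u₁, ∀ p o : List Q,
      (transEdge δ F L u₁ v p o w ↔ transEdge δ F L u₂ (φ v) p o (φ w))


/-- The state reached after reading the length-`n` prefix of an ω-word, starting in `q`, in the
complete automaton with next-state function `t`. -/
def stateAfter (t : Q → A → Q) (q : Q) (ξ : ℕ → A) : ℕ → Q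
  | 0 => q
  | n + 1 => t (stateAfter t q ξ n) (ξ n)

/-- The action of the state `q` on ω-words in the complete automaton with output function `o`
and next-state function `t`. -/
def omegaAct (o : Q → A → A) (t : Q → A → Q) (q : Q) (ξ : ℕ → A) (n : ℕ) : A :=
  o (stateAfter t q ξ n) (ξ n)

/-- The ω-word `ξ` with its length-`m` prefix removed. -/
def omegaDrop (m : ℕ) (ξ : ℕ → A) (n : ℕ) : A := ξ (m + n)

theorem stateAfter_add (t : Q → A → Q) (q : Q) (ξ : ℕ → A) (m n : ℕ) :
    stateAfter t q ξ (m + n) = stateAfter t (stateAfter t q ξ m) (omegaDrop m ξ) n := by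
  induction n with
  | zero => rfl
  | succ n ih => rw [← Nat.add_assoc, stateAfter, stateAfter, ih, omegaDrop]

theorem omegaDrop_omegaAct (o : Q → A → A) (t : Q → A → Q) (q : Q) (ξ : ℕ → A) (m : ℕ) :
    omegaDrop m (omegaAct o t q ξ) = omegaAct o t (stateAfter t q ξ m) (omegaDrop m ξ) := by
  funext n
  simp only [omegaDrop, omegaAct, stateAfter_add]

theorem stateAfter_injective {t : Q → A → Q} (ht : ∀ a, Function.Injective fun q => t q a)
    (ξ : ℕ → A) (n : ℕ) : Function.Injective fun q => stateAfter t q ξ n := by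
  induction n with
  | zero => exact fun _ _ h => h
  | succ n ih => exact fun _ _ h => ih (ht (ξ n) h)

theorem omegaAct_injective {o : Q → A → A} (t : Q → A → Q) (ho : ∀ q, Function.Injective (o q))
    (q : Q) : Function.Injective (omegaAct o t q) := by
  intro ξ η h
  have hs : ∀ n, stateAfter t q ξ n = stateAfter t q η n → ξ n = η n := fun n hn =>
    ho (stateAfter t q ξ n) <| by simpa only [omegaAct, ← hn] using congrFun h n
  have key : ∀ n, stateAfter t q ξ n = stateAfter t q η n := by
    intro n
    induction n with
    | zero => rfl
    | succ n ih => rw [stateAfter, stateAfter, ih, hs n ih]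
  exact funext fun n => hs n (key n)

theorem pre_succ (ξ : ℕ → A) (n : ℕ) : pre ξ (n + 1) = ξ 0 :: pre (omegaDrop 1 ξ) n := by
  simp [pre, List.ofFn_succ, omegaDrop, Nat.add_comm]

theorem stateAct_pre {δ : Q → A → Option (A × Q)} {o : Q → A → A} {t : Q → A → Q}
    (hδ : ∀ q a, δ q a = some (o q a, t q a)) (q : Q) (ξ : ℕ → A) (n : ℕ) :
    stateAct δ q (pre ξ n) = some (pre (omegaAct o t q ξ) n) := by
  induction n generalizing q ξ with
  | zero => simp [pre, stateAct]
  | succ n ih =>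
    rw [pre_succ, pre_succ, omegaDrop_omegaAct, stateAct, hδ]
    simp [ih, omegaAct, stateAfter]

theorem self_mem_omegaOrbit (δ : Q → A → Option (A × Q)) (ξ : ℕ → A) :
    ξ ∈ omegaOrbit δ Set.univ ξ :=
  ⟨[], Set.mem_univ _, fun _ => rfl⟩

theorem omegaAct_mem_omegaOrbit {δ : Q → A → Option (A × Q)} {o : Q → A → A} {t : Q → A → Q}
    (hδ : ∀ q a, δ q a = some (o q a, t q a)) {ξ η : ℕ → A}
    (hη : η ∈ omegaOrbit δ Set.univ ξ) (q : Q) :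
    omegaAct o t q η ∈ omegaOrbit δ Set.univ ξ := by
  obtain ⟨l, -, hl⟩ := hη
  refine ⟨q :: l, Set.mem_univ _, fun n => ?_⟩
  have h : seqAct δ (q :: l) (pre ξ n) = (seqAct δ l (pre ξ n)).bind (stateAct δ q) := rfl
  rw [h, hl, Option.bind_some, stateAct_pre hδ]

/-- If a finite set of ω-words is invariant under a reversible automaton, then deleting a suitable
prefix yields an invariant set in which a common nonempty prefix length fixes every state. -/
theorem exists_invariant_returning [Finite Q] {o : Q → A → A} {t : Q → A → Q}
    (ht : ∀ a, Function.Injective fun q => t q a) {O : Set (ℕ → A)} (hO : O.Finite)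
    (hclosed : ∀ ξ ∈ O, ∀ q, omegaAct o t q ξ ∈ O) :
    ∃ m k, (∀ ξ ∈ omegaDrop m '' O, ∀ q, omegaAct o t q ξ ∈ omegaDrop m '' O) ∧
      ∀ ξ ∈ omegaDrop m '' O, ∀ q, stateAfter t q ξ (1 + k) = q := by
  have : Finite O := hO
  obtain ⟨m, n, hmn, h⟩ : ∃ m n, m < n ∧
      ∀ ξ ∈ O, ∀ q, stateAfter t q ξ m = stateAfter t q ξ n := by
    obtain ⟨m, n, hne, h⟩ := Finite.exists_ne_map_eq_of_infinite
      fun (n : ℕ) (ξ : O) (q : Q) => stateAfter t q ξ.1 n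
    have h' : ∀ ξ ∈ O, ∀ q, stateAfter t q ξ m = stateAfter t q ξ n :=
      fun ξ hξ q => congrFun (congrFun h ⟨ξ, hξ⟩) q
    rcases lt_or_gt_of_ne hne with hlt | hlt
    · exact ⟨m, n, hlt, h'⟩
    · exact ⟨n, m, hlt, fun ξ hξ q => (h' ξ hξ q).symm⟩
  obtain ⟨k, rfl⟩ := Nat.exists_eq_add_of_lt hmn
  have hsurj : ∀ ξ p, ∃ q, stateAfter t q ξ m = p := fun ξ =>
    Finite.surjective_of_injective (stateAfter_injective ht ξ m)
  refine ⟨m, k, ?_, ?_⟩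
  · rintro _ ⟨ξ, hξ, rfl⟩ p
    obtain ⟨q, rfl⟩ := hsurj ξ p
    exact ⟨_, hclosed ξ hξ q, omegaDrop_omegaAct o t q ξ m⟩
  · rintro _ ⟨ξ, hξ, rfl⟩ p
    obtain ⟨q, rfl⟩ := hsurj ξ p
    rw [← stateAfter_add, h ξ hξ q]
    congr 1
    omega

/-- A returning invariant set of ω-words forces the inverse automaton to be reversible at the
output letters that start one of its words. -/
theorem eq_of_invariant_returning {o : Q → A → A} {t : Q → A → Q}
    (ho : ∀ q, Function.Injective (o q)) {S : Set (ℕ → A)} (hS : S.Finite)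
    (hclosed : ∀ ξ ∈ S, ∀ q, omegaAct o t q ξ ∈ S) {k : ℕ}
    (hret : ∀ ξ ∈ S, ∀ q, stateAfter t q ξ (1 + k) = q) {ω : ℕ → A} (hω : ω ∈ S)
    {q₁ q₂ : Q} {a₁ a₂ : A} (h₁ : o q₁ a₁ = ω 0) (h₂ : o q₂ a₂ = ω 0)
    (ht : t q₁ a₁ = t q₂ a₂) : q₁ = q₂ := by
  have hpre : ∀ q a, o q a = ω 0 → ∃ ζ ∈ S, omegaAct o t q ζ = ω ∧ ζ 0 = a := by
    intro q a h
    obtain ⟨ζ, hζ, e⟩ := ((hS.injOn_iff_bijOn_of_mapsTo fun ξ hξ => hclosed ξ hξ q).1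
      (omegaAct_injective t ho q).injOn).surjOn hω
    exact ⟨ζ, hζ, e, ho q ((congrFun e 0).trans h.symm)⟩
  obtain ⟨ζ₁, hζ₁, e₁, rfl⟩ := hpre q₁ a₁ h₁
  obtain ⟨ζ₂, hζ₂, e₂, rfl⟩ := hpre q₂ a₂ h₂
  have hst : stateAfter t q₁ ζ₁ 1 = stateAfter t q₂ ζ₂ 1 := ht
  have htail : omegaDrop 1 ζ₁ = omegaDrop 1 ζ₂ := by
    apply omegaAct_injective t ho (stateAfter t q₁ ζ₁ 1)
    rw [← omegaDrop_omegaAct, e₁, hst, ← omegaDrop_omegaAct, e₂]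
  rw [← hret ζ₁ hζ₁ q₁, ← hret ζ₂ hζ₂ q₂, stateAfter_add, stateAfter_add, hst, htail]

/-- If the dual automaton is connected, a nonempty set of letters invariant under the injective
output functions is everything. -/
theorem mem_of_dual_connected [Finite A] {δ : Q → A → Option (A × Q)} {o : Q → A → A}
    {t : Q → A → Q} (hδ : ∀ q a, δ q a = some (o q a, t q a))
    (ho : ∀ q, Function.Injective (o q)) {F : Set A} (hF : ∀ a ∈ F, ∀ q, o q a ∈ F)
    {a b : A} (ha : a ∈ F) (hab : Relation.ReflTransGen (Adj (dual δ)) a b) : b ∈ F := by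
  induction hab with
  | refl => exact ha
  | tail _ hadj ih =>
    rcases hadj with ⟨q, p, h⟩ | ⟨q, p, h⟩
    · simp only [dual, hδ, Option.map_some, Option.some.injEq, Prod.mk.injEq] at h
      exact h.2 ▸ hF _ ih q
    · simp only [dual, hδ, Option.map_some, Option.some.injEq, Prod.mk.injEq] at h
      obtain ⟨c, hc, e⟩ := ((F.toFinite.injOn_iff_bijOn_of_mapsTo fun a ha => hF a ha q).1
        (ho q).injOn).surjOn ih
      exact ho q (e.trans h.2.symm) ▸ hc

/-- Let `T` be a reversible but not bi-reversible G-automaton whose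
dual automaton `∂T` is connected. Then every ω-word `ξ ∈ Σ^ω` has an infinite orbit
`Q*∘ξ`. -/
theorem all_orbits_infinite_of_connected_dual {Q A : Type*} [Fintype Q] [Fintype A]
    [Nonempty A] (δ : Q → A → Option (A × Q)) (hG : GAutomaton δ) (hRev : Reversible δ)
    (hnBi : ¬ BiReversible δ)
    (hconn : ∀ a b : A, Relation.ReflTransGen (Adj (dual δ)) a b) :
    ∀ ξ : ℕ → A, (omegaOrbit δ (Set.univ : Set (List Q)) ξ).Infinite := by
  have hex : ∀ q a, ∃ x : A × Q, δ q a = some x := fun q a => Option.isSome_iff_exists.1 (hG.1 q a)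
  choose f hf using hex
  set o : Q → A → A := fun q a => (f q a).1
  set t : Q → A → Q := fun q a => (f q a).2
  have hδ : ∀ q a, δ q a = some (o q a, t q a) := hf
  have ho : ∀ q, Function.Injective (o q) := fun q a a' h =>
    (hG.2 q (o q a)).unique ⟨_, hδ q a⟩ ⟨t q a', h ▸ hδ q a'⟩
  have ht : ∀ a, Function.Injective fun q => t q a := fun a q q' h => by
    refine hRev a (t q a) q (o q a) q' (o q' a) (hδ q a) ?_
    rw [hδ, show t q' a = t q a from h.symm]
  intro ξ hfin
  obtain ⟨m, k, hclosed, hret⟩ := exists_invariant_returning ht hfin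
    fun η hη q => omegaAct_mem_omegaOrbit hδ hη q
  set S := omegaDrop m '' omegaOrbit δ Set.univ ξ
  refine hnBi ⟨hRev, fun b p q₁ a₁ q₂ a₂ h₁ h₂ => ?_⟩
  rw [hδ, Option.some.injEq, Prod.mk.injEq] at h₁ h₂
  obtain ⟨ω, hω, rfl⟩ : b ∈ (fun η : ℕ → A => η 0) '' S := by
    refine mem_of_dual_connected hδ ho ?_
      ⟨_, ⟨ξ, self_mem_omegaOrbit δ ξ, rfl⟩, rfl⟩ (hconn _ b)
    rintro _ ⟨η, hη, rfl⟩ q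
    exact ⟨_, hclosed η hη q, rfl⟩
  have hq : q₁ = q₂ := eq_of_invariant_returning ho (hfin.image _) hclosed hret hω h₁.1 h₂.1
    (h₁.2.trans h₂.2.symm)
  subst hq
  exact ⟨rfl, ho q₁ (h₁.1.trans h₂.1.symm)⟩

end AutOrbit
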